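/- Let T(α,β) := ∑_{n=1}^∞ C(-β,2n)·2/(2n-α) - 2/α + [₂F₁(β,α+β,1+α+β;1) + ₂F₁(β,α+β,1+α+β;-1)]/(α+β) for α ∈ (0,2), β ∈ (0,1). Then lim_{β→0⁺} T(α,β)/β = R₁(α) = -π·cot(πα/2)/α for each fixed α ∈ (0,2). -/

import Mathlib

open Real Filter

/-- The Gauss hypergeometric function `₂F₁(a,b,c;z)`, via the Euler integral
representation (valid for `c > b > 0`). -/
noncomputable def hyp2F1 (a b c z : ℝ) : ℝ :=
  (Real.Gamma c / (Real.Gamma b * Real.Gamma (c - b))) *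
    ∫ t in (0:ℝ)..1, t ^ (b - 1) * (1 - t) ^ (c - b - 1) * (1 - t * z) ^ (-a)

/-- Generalized binomial coefficient `C(z,k) = z(z-1)⋯(z-k+1)/k!`. -/
noncomputable def gbinom (z : ℝ) (k : ℕ) : ℝ :=
  (∏ i ∈ Finset.range k, (z - (i : ℝ))) / (Nat.factorial k : ℝ)

/-- The transience constant `T(α,β)`. -/
noncomputable def Tconst (α β : ℝ) : ℝ :=
  (∑' n : ℕ, gbinom (-β) (2 * (n + 1)) * (2 / (2 * ((n : ℝ) + 1) - α))) - 2 / α +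
    (hyp2F1 β (α + β) (1 + α + β) 1 + hyp2F1 β (α + β) (1 + α + β) (-1)) / (α + β)

/-- `R₁(α) = -π · cot(πα/2) / α`. -/
noncomputable def R1 (α : ℝ) : ℝ :=
  -π * (Real.cos (π * α / 2) / Real.sin (π * α / 2)) / α

lemma gbinom_succ (z : ℝ) (k : ℕ) : gbinom z (k + 1) = gbinom z k * ((z - k) / (k + 1)) := by
  unfold gbinom
  rw [Finset.prod_range_succ, Nat.factorial_succ]
  push_cast
  have : ((k.factorial : ℕ) : ℝ) ≠ 0 := by positivity
  field_simp

lemma gbinom_zero (z : ℝ) : gbinom z 0 = 1 := by simp [gbinom]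

lemma gbinom_eq_choose (z : ℝ) (k : ℕ) : gbinom z k = Ring.choose z k := by
  rw [Ring.choose_eq_smul]
  unfold gbinom
  rw [← Polynomial.aeval_eq_smeval, Polynomial.aeval_def, ← Polynomial.eval_map,
    descPochhammer_map, descPochhammer_eval_eq_prod_range]
  rw [smul_eq_mul, div_eq_inv_mul]

lemma sqrt_step (x β : ℝ) (hx : 1 ≤ x) (hβ : 0 < β) (hβ' : β ≤ 1 / 4) :
    (√x)⁻¹ * ((x + β) / (x + 1)) ≤ (√(x + 1))⁻¹ := by
  have h1 : 0 < √x := by positivity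
  have h2 : 0 < √(x + 1) := by positivity
  have s2 : √(x + 1) * √(x + 1) = x + 1 := Real.mul_self_sqrt (by linarith)
  have key : (x + β) ≤ √x * √(x + 1) := by
    rw [← Real.sqrt_mul (by linarith)]
    apply Real.le_sqrt_of_sq_le
    nlinarith
  rw [inv_mul_eq_div, div_div, div_le_iff₀ (by positivity)]
  calc x + β ≤ √x * √(x + 1) := key
    _ = (√(x + 1))⁻¹ * ((√(x + 1) * √(x + 1)) * √x) := by field_simp
    _ = _ := by rw [s2]

lemma gbinom_bound (β : ℝ) (hβ : 0 < β) (hβ' : β ≤ 1 / 4) (k : ℕ) :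
    |gbinom (-β) (k + 1)| ≤ β * (√((k : ℝ) + 1))⁻¹ := by
  induction k with
  | zero => simp [gbinom, abs_of_pos hβ]
  | succ k ih =>
    rw [gbinom_succ, abs_mul]
    have hk : (0 : ℝ) ≤ k := Nat.cast_nonneg k
    have e : |(-β - ((k + 1 : ℕ) : ℝ)) / (((k + 1 : ℕ) : ℝ) + 1)| =
        (((k : ℝ) + 1) + β) / (((k : ℝ) + 1) + 1) := by
      push_cast
      rw [abs_div, abs_of_pos (show (0 : ℝ) < k + 1 + 1 by linarith),
        abs_of_neg (by linarith)]
      ring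
    rw [e]
    have := sqrt_step ((k : ℝ) + 1) β (by linarith) hβ hβ'
    push_cast
    calc _ ≤ (β * (√((k : ℝ) + 1))⁻¹) * ((((k : ℝ) + 1) + β) / (((k : ℝ) + 1) + 1)) := by gcongr
      _ = β * ((√((k : ℝ) + 1))⁻¹ * ((((k : ℝ) + 1) + β) / (((k : ℝ) + 1) + 1))) := by ring
      _ ≤ _ := by gcongr

lemma gbinom_div_tendsto (k : ℕ) :
    Tendsto (fun β : ℝ => gbinom (-β) (k + 1) / β) (nhdsWithin 0 (Set.Ioi 0))
      (nhds ((-1) ^ (k + 1) / ((k : ℝ) + 1))) := by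
  induction k with
  | zero =>
    apply Tendsto.congr' (f₁ := fun _ => (-1 : ℝ))
    · filter_upwards [self_mem_nhdsWithin] with β hβ
      have : β ≠ 0 := ne_of_gt hβ
      simp [gbinom]
      field_simp
    · simp
  | succ k ih =>
    have h : Tendsto (fun β : ℝ => (-β - ((k + 1 : ℕ) : ℝ)) / (((k + 1 : ℕ) : ℝ) + 1))
        (nhdsWithin 0 (Set.Ioi 0)) (nhds ((-0 - ((k + 1 : ℕ) : ℝ)) / (((k + 1 : ℕ) : ℝ) + 1))) := by
      apply Tendsto.mono_left _ nhdsWithin_le_nhds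
      apply Continuous.tendsto (f := fun β : ℝ => (-β - ((k + 1 : ℕ) : ℝ)) / (((k + 1 : ℕ) : ℝ) + 1))
      fun_prop
    convert ih.mul h using 2
    · rw [gbinom_succ]; ring
    · push_cast
      field_simp
      ring

lemma summable_base : Summable (fun n : ℕ => (√((n : ℝ) + 1))⁻¹ * ((n : ℝ) + 1)⁻¹) := by
  have h := (summable_nat_add_iff 1).mpr (Real.summable_nat_rpow (p := -(3 / 2))|>.mpr (by norm_num))
  refine h.congr fun n => ?_
  have : (0 : ℝ) < n + 1 := by positivity
  push_cast
  rw [Real.sqrt_eq_rpow, ← Real.rpow_neg this.le]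
  rw [← Real.rpow_neg_one ((n : ℝ) + 1), ← Real.rpow_add this]
  norm_num

lemma summable_coef (β b : ℝ) (hβ : 0 < β) (hβ' : β ≤ 1 / 4) (hb : 0 < b) :
    Summable (fun k : ℕ => |gbinom (-β) k| * ((k : ℝ) + b)⁻¹) := by
  rw [← summable_nat_add_iff 1]
  refine Summable.of_nonneg_of_le (fun k => by positivity) (fun k => ?_) (summable_base.mul_left β)
  push_cast
  rw [← mul_assoc]
  have hk : (0 : ℝ) < (k : ℝ) + 1 := by positivity
  exact mul_le_mul (gbinom_bound β hβ hβ' k) (inv_anti₀ hk (by linarith)) (by positivity)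
    (by positivity)

lemma hyp_eq (β b z : ℝ) (hb : 0 < b) :
    hyp2F1 β b (1 + b) z / b = ∫ t in Set.Ioo (0 : ℝ) 1, t ^ (b - 1) * (1 - t * z) ^ (-β) := by
  unfold hyp2F1
  rw [intervalIntegral.integral_of_le zero_le_one, MeasureTheory.integral_Ioc_eq_integral_Ioo]
  have h1 : (1 : ℝ) + b - b = 1 := by ring
  have hg : Real.Gamma b ≠ 0 := (Real.Gamma_pos_of_pos hb).ne'
  rw [h1, add_comm 1 b, Real.Gamma_add_one hb.ne', Real.Gamma_one]
  simp only [sub_self, Real.rpow_zero, mul_one]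
  rw [mul_div_right_comm, mul_div_assoc, div_self hg, mul_one, div_self hb.ne', one_mul]

lemma binom_hasSum (a x : ℝ) (hx : |x| < 1) :
    HasSum (fun k : ℕ => gbinom a k * x ^ k) ((1 + x) ^ a) := by
  have := (Real.one_add_rpow_hasFPowerSeriesOnBall_zero (a := a)).hasSum (y := x) (by
    simpa [Metric.mem_eball, edist_dist, ← ofReal_norm, ENNReal.ofReal_lt_one] using hx)
  simp only [binomialSeries_apply, zero_add, List.ofFn_const, List.prod_replicate,
    smul_eq_mul] at this
  simpa only [gbinom_eq_choose] using this

lemma hyp_hasSum (β b z : ℝ) (hβ : 0 < β) (hβ' : β ≤ 1 / 4) (hb : 0 < b) (hz : |z| = 1) :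
    HasSum (fun k : ℕ => gbinom (-β) k * (-z) ^ k * ((k : ℝ) + b)⁻¹)
      (hyp2F1 β b (1 + b) z / b) := by
  rw [hyp_eq β b z hb]
  let F : ℕ → ℝ → ℝ := fun k t => gbinom (-β) k * (-z) ^ k * t ^ ((k : ℝ) + b - 1)
  have hlt : ∀ k : ℕ, -1 < (k : ℝ) + b - 1 := fun k => by
    have : (0 : ℝ) ≤ k := Nat.cast_nonneg k
    linarith
  have hI : ∀ k : ℕ, ∫ t in Set.Ioo (0 : ℝ) 1, t ^ ((k : ℝ) + b - 1) = ((k : ℝ) + b)⁻¹ := fun k => by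
    rw [← MeasureTheory.integral_Ioc_eq_integral_Ioo, ← intervalIntegral.integral_of_le zero_le_one,
      integral_rpow (Or.inl (hlt k))]
    have : (k : ℝ) + b ≠ 0 := by positivity
    simp [Real.zero_rpow this]
  have hIntOn : ∀ k : ℕ, MeasureTheory.IntegrableOn (fun t : ℝ => t ^ ((k : ℝ) + b - 1)) (Set.Ioo 0 1) :=
    fun k => ((intervalIntegral.intervalIntegrable_rpow' (a := 0) (b := 1) (hlt k)).1).mono_set
      Set.Ioo_subset_Ioc_self
  have hF : ∀ k, MeasureTheory.Integrable (F k) (MeasureTheory.volume.restrict (Set.Ioo 0 1)) :=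
    fun k => (hIntOn k).const_mul _
  have hS : Summable fun k => ∫ t in Set.Ioo (0 : ℝ) 1, ‖F k t‖ := by
    refine (summable_coef β b hβ hβ' hb).congr fun k => ?_
    rw [← hI k, ← MeasureTheory.integral_const_mul]
    apply MeasureTheory.setIntegral_congr_fun measurableSet_Ioo
    intro t ht
    simp only [F, norm_mul, norm_pow, norm_neg, Real.norm_eq_abs, hz, one_pow, mul_one]
    rw [abs_of_nonneg (Real.rpow_nonneg ht.1.le _)]
  have := MeasureTheory.hasSum_integral_of_summable_integral_norm hF hS
  convert! this using 1
  · funext k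
    simp only [F]
    rw [MeasureTheory.integral_const_mul, hI]
  · apply MeasureTheory.setIntegral_congr_fun measurableSet_Ioo
    intro t ht
    have hb := binom_hasSum (-β) (t * (-z)) (by
      rw [abs_mul, abs_neg, hz, mul_one, abs_of_pos ht.1]; exact ht.2)
    have := (hb.mul_left (t ^ (b - 1))).tsum_eq
    simp only
    rw [show 1 - t * z = 1 + t * (-z) by ring, ← this]
    apply tsum_congr
    intro k
    simp only [F]
    rw [show (k : ℝ) + b - 1 = (b - 1) + k by ring, Real.rpow_add ht.1, Real.rpow_natCast, mul_pow]
    ring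

lemma sum_hasSum (β b : ℝ) (hβ : 0 < β) (hβ' : β ≤ 1 / 4) (hb : 0 < b) :
    HasSum (fun n : ℕ => gbinom (-β) (2 * (n + 1)) * (2 / (2 * ((n : ℝ) + 1) + b)))
      ((hyp2F1 β b (1 + b) 1 + hyp2F1 β b (1 + b) (-1)) / b - 2 / b) := by
  have h := (hyp_hasSum β b 1 hβ hβ' hb (by simp)).add (hyp_hasSum β b (-1) hβ hβ' hb (by simp))
  rw [← add_div] at h
  have hinj : Function.Injective (fun n : ℕ => 2 * n) := fun a b h => by simpa using h
  rw [← hinj.hasSum_iff] at h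
  · rw [← hasSum_nat_add_iff' 1] at h
    convert! h using 1
    · funext n
      have he : (-1 : ℝ) ^ (2 * (n + 1)) = 1 := by rw [pow_mul]; norm_num
      simp only [Function.comp, neg_neg, one_pow, he]
      push_cast
      ring
    · simp [gbinom_zero]
      ring
  · intro x hx
    have : Odd x := by
      rw [← Nat.not_even_iff_odd]
      rintro ⟨r, hr⟩
      exact hx ⟨r, by simp only; omega⟩
    simp [this.neg_one_pow]

lemma dom_bound (α : ℝ) (hα : α ∈ Set.Ioo (0 : ℝ) 2) (β : ℝ) (hβ : 0 < β) (hβ' : β ≤ 1 / 4)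
    (n : ℕ) (y : ℝ) (hy : (2 - α) * ((n : ℝ) + 1) ≤ y) :
    ‖gbinom (-β) (2 * (n + 1)) / β * (2 / y)‖ ≤
      2 / (2 - α) * ((√((n : ℝ) + 1))⁻¹ * ((n : ℝ) + 1)⁻¹) := by
  have h2 : 0 < 2 - α := by linarith [hα.2]
  have hn : (0 : ℝ) < n + 1 := by positivity
  have hy0 : 0 < y := lt_of_lt_of_le (by positivity) hy
  have h := gbinom_bound β hβ hβ' (2 * n + 1)
  rw [norm_mul, norm_div, Real.norm_eq_abs, Real.norm_eq_abs, Real.norm_eq_abs, abs_of_pos hβ,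
    abs_of_pos (show 0 < 2 / y by positivity)]
  have h3 : |gbinom (-β) (2 * (n + 1))| / β ≤ (√((n : ℝ) + 1))⁻¹ := by
    rw [div_le_iff₀ hβ, mul_comm _ β]
    refine h.trans ?_
    push_cast
    gcongr
    linarith
  calc _ ≤ (√((n : ℝ) + 1))⁻¹ * (2 / ((2 - α) * ((n : ℝ) + 1))) := by gcongr
    _ = _ := by field_simp

lemma cot_sum (α : ℝ) (hα : α ∈ Set.Ioo (0 : ℝ) 2) :
    R1 α = (∑' n : ℕ, 1 / (2 * ((n : ℝ) + 1)) *
      (2 / (2 * ((n : ℝ) + 1) - α) + 2 / (2 * ((n : ℝ) + 1) + α))) - 2 / α ^ 2 := by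
  obtain ⟨h0, h2⟩ := hα
  have hx : ((α / 2 : ℝ) : ℂ) ∈ Complex.integerComplement := by
    rw [Complex.mem_integerComplement_iff]
    rintro ⟨n, hn⟩
    have hn' : (n : ℝ) = α / 2 := by exact_mod_cast hn
    have a1 : (0 : ℝ) < n := by linarith
    have a2 : (n : ℝ) < 1 := by linarith
    have : 0 < n := by exact_mod_cast a1
    have : n < 1 := by exact_mod_cast a2
    omega
  have h := cot_series_rep' hx
  have h' : π * (Real.cos (π * α / 2) / Real.sin (π * α / 2)) - 2 / α =
      ∑' n : ℕ, (1 / (α / 2 - ((n : ℝ) + 1)) + 1 / (α / 2 + ((n : ℝ) + 1))) := by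
    rw [← Complex.ofReal_inj]
    push_cast
    rw [Complex.cot_eq_cos_div_sin] at h
    push_cast at h
    rw [← h]
    congr 1
    · rw [mul_div_assoc]
    · field_simp
  have h'' : R1 α = -(1 / α) * (π * (Real.cos (π * α / 2) / Real.sin (π * α / 2)) - 2 / α)
      - 2 / α ^ 2 := by
    unfold R1
    field_simp
    ring
  rw [h'', h', ← tsum_mul_left]
  congr 2
  funext n
  have hn : (0 : ℝ) ≤ n := Nat.cast_nonneg n
  have e1 : 2 * ((n : ℝ) + 1) - α ≠ 0 := by
    have : 0 < 2 * ((n : ℝ) + 1) - α := by linarith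
    exact this.ne'
  have e2 : 2 * ((n : ℝ) + 1) + α ≠ 0 := by positivity
  have e3 : α / 2 - ((n : ℝ) + 1) = -(2 * ((n : ℝ) + 1) - α) / 2 := by ring
  have e4 : α / 2 + ((n : ℝ) + 1) = (2 * ((n : ℝ) + 1) + α) / 2 := by ring
  rw [e3, e4]
  field_simp
  ring

theorem T_div_beta_tendsto_R1 (α : ℝ) (hα : α ∈ Set.Ioo (0 : ℝ) 2) :
    Tendsto (fun β : ℝ => Tconst α β / β) (nhdsWithin 0 (Set.Ioi 0)) (nhds (R1 α)) := by
  have h0 := hα.1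
  have h2 := hα.2
  have hev : ∀ᶠ β : ℝ in nhdsWithin 0 (Set.Ioi 0), 0 < β ∧ β ≤ 1 / 4 := by
    filter_upwards [Ioc_mem_nhdsGT (show (0 : ℝ) < 1 / 4 by norm_num)] with β hβ using hβ
  have hy1 : ∀ n : ℕ, (2 - α) * ((n : ℝ) + 1) ≤ 2 * ((n : ℝ) + 1) - α := fun n => by
    have hn : (0 : ℝ) ≤ n := Nat.cast_nonneg n
    nlinarith
  have hy2 : ∀ n : ℕ, ∀ β : ℝ, 0 < β → (2 - α) * ((n : ℝ) + 1) ≤ 2 * ((n : ℝ) + 1) + (α + β) :=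
    fun n β hβ => by
      have hn : (0 : ℝ) ≤ n := Nat.cast_nonneg n
      nlinarith
  rw [cot_sum α hα]
  let f : ℝ → ℕ → ℝ := fun β n => gbinom (-β) (2 * (n + 1)) / β *
    (2 / (2 * ((n : ℝ) + 1) - α) + 2 / (2 * ((n : ℝ) + 1) + (α + β)))
  have heq : ∀ᶠ β : ℝ in nhdsWithin 0 (Set.Ioi 0),
      (∑' n, f β n) - 2 / (α * (α + β)) = Tconst α β / β := by
    filter_upwards [hev] with β hβ
    obtain ⟨hβ, hβ'⟩ := hβ
    have hs := sum_hasSum β (α + β) hβ hβ' (by linarith)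
    have hs1 : Summable (fun n : ℕ => gbinom (-β) (2 * (n + 1)) / β * (2 / (2 * ((n : ℝ) + 1) - α))) :=
      Summable.of_norm_bounded (summable_base.mul_left (2 / (2 - α)))
        (fun n => dom_bound α hα β hβ hβ' n _ (hy1 n))
    have e1 := (hs1.hasSum.add (hs.div_const β)).tsum_eq
    have e2 : ∑' n, f β n = ∑' n : ℕ, (gbinom (-β) (2 * (n + 1)) / β * (2 / (2 * ((n : ℝ) + 1) - α)) +
        gbinom (-β) (2 * (n + 1)) * (2 / (2 * ((n : ℝ) + 1) + (α + β))) / β) := by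
      apply tsum_congr
      intro n
      simp only [f]
      ring
    have e3 : ∑' n : ℕ, gbinom (-β) (2 * (n + 1)) / β * (2 / (2 * ((n : ℝ) + 1) - α)) =
        (∑' n : ℕ, gbinom (-β) (2 * (n + 1)) * (2 / (2 * ((n : ℝ) + 1) - α))) / β := by
      rw [← tsum_div_const]
      apply tsum_congr
      intro n
      ring
    rw [e2, e1, e3]
    unfold Tconst
    rw [← add_assoc 1 α β] at *
    generalize (∑' n : ℕ, gbinom (-β) (2 * (n + 1)) * (2 / (2 * ((n : ℝ) + 1) - α))) = S
    generalize hyp2F1 β (α + β) (1 + α + β) 1 + hyp2F1 β (α + β) (1 + α + β) (-1) = H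
    have : α + β ≠ 0 := by positivity
    field_simp
    ring
  refine Tendsto.congr' heq ?_
  refine Tendsto.sub ?_ ?_
  · refine tendsto_tsum_of_dominated_convergence
      (bound := fun n : ℕ => 2 / (2 - α) * ((√((n : ℝ) + 1))⁻¹ * ((n : ℝ) + 1)⁻¹) +
        2 / (2 - α) * ((√((n : ℝ) + 1))⁻¹ * ((n : ℝ) + 1)⁻¹))
      ((summable_base.mul_left _).add (summable_base.mul_left _)) ?_ ?_
    · intro n
      refine Tendsto.mul ?_ ?_
      · have hg := gbinom_div_tendsto (2 * n + 1)
        have : Even (2 * n + 1 + 1) := ⟨n + 1, by ring⟩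
        rw [this.neg_one_pow] at hg
        push_cast at hg
        rw [show (2 * (n : ℝ) + 1 + 1) = 2 * ((n : ℝ) + 1) by ring] at hg
        exact hg
      · refine tendsto_const_nhds.add ?_
        apply Tendsto.mono_left _ nhdsWithin_le_nhds
        have : ContinuousAt (fun β : ℝ => 2 / (2 * ((n : ℝ) + 1) + (α + β))) 0 := by
          apply ContinuousAt.div (by fun_prop) (by fun_prop)
          positivity
        simpa [ContinuousAt] using this
    · filter_upwards [hev] with β hβ n
      simp only [f]
      rw [mul_add]
      exact (norm_add_le _ _).trans (add_le_add (dom_bound α hα β hβ.1 hβ.2 n _ (hy1 n))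
        (dom_bound α hα β hβ.1 hβ.2 n _ (hy2 n β hβ.1)))
  · apply Tendsto.mono_left _ nhdsWithin_le_nhds
    have : ContinuousAt (fun β : ℝ => 2 / (α * (α + β))) 0 := by
      apply ContinuousAt.div (by fun_prop) (by fun_prop)
      simp only [add_zero]
      positivity
    simpa [ContinuousAt, sq] using this
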